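/- arXiv:2402.04076 — 2 statements merged into one kernel-verified Lean document; each statement's English description precedes it below -/
import Mathlib

section
/- Let n ≥ 1 be an integer. There exists a constant C > 0 depending only on n with the following property. Let s ∈ (0,2), and let U be a bounded continuous function on the closure of the half-ball B₂⁺ := {(x,z) ∈ ℝⁿ × (0,∞) : |x|² + z² < 4}, smooth in B₂⁺, satisfying Δ_x U + ∂_{zz} U + ((1−s)/z) ∂_z U = 0 in B₂⁺, and with U(x,0) = 0 for all x ∈ ℝⁿ with |x| < 3/2. Then for every (x,z) ∈ B₁⁺ := {(x,z) : |x|² + z² < 1, z > 0}, one has z^{1−s} |∇U(x,z)| ≤ (C/s) · sup_{B_{6/5}⁺} |U|, where ∇U denotes the full gradient in ℝ^{n+1} and B_{6/5}⁺ := {(x,z) : |x|² + z² < (6/5)², z > 0}. -/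
open MeasureTheory Real Set

open Filter Topology

/-- `f` is differentiable near `t` with derivative `a` at `t`, and its derivative has
derivative `b` at `t`. -/
def HasSecondDeriv (f : ℝ → ℝ) (a b t : ℝ) : Prop :=
  ∃ g : ℝ → ℝ, (∀ᶠ y in 𝓝 t, HasDerivAt f (g y) y) ∧ g t = a ∧ HasDerivAt g b t

namespace HasSecondDeriv

variable {f f₁ f₂ : ℝ → ℝ} {a a₁ a₂ b b₁ b₂ t : ℝ}

theorem hasDerivAt (h : HasSecondDeriv f a b t) : HasDerivAt f a t := by
  obtain ⟨g, h1, rfl, -⟩ := h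
  exact h1.self_of_nhds

theorem of_contDiffAt (h : ContDiffAt ℝ 2 f t) :
    HasSecondDeriv f (deriv f t) (deriv (deriv f) t) t := by
  refine ⟨deriv f, ?_, rfl, ?_⟩
  · filter_upwards [h.eventually (by simp)] with y hy
    exact (hy.differentiableAt (by simp)).hasDerivAt
  · have h2 : ContDiffAt ℝ 1 (deriv f) t := by
      simpa using (h.fderiv_right (m := 1) (by norm_num)).clm_apply
        (contDiffAt_const (c := (1 : ℝ)))
    exact (h2.differentiableAt (by simp)).hasDerivAt

theorem congr_coeff (h : HasSecondDeriv f a₁ b₁ t) (ha : a₁ = a) (hb : b₁ = b) :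
    HasSecondDeriv f a b t := ha ▸ hb ▸ h

theorem neg (h : HasSecondDeriv f a b t) : HasSecondDeriv (fun y => -f y) (-a) (-b) t := by
  obtain ⟨g, h1, rfl, h2⟩ := h
  exact ⟨fun y => -g y, h1.mono fun y hy => hy.fun_neg, rfl, h2.fun_neg⟩

theorem add (h₁ : HasSecondDeriv f₁ a₁ b₁ t) (h₂ : HasSecondDeriv f₂ a₂ b₂ t) :
    HasSecondDeriv (fun y => f₁ y + f₂ y) (a₁ + a₂) (b₁ + b₂) t := by
  obtain ⟨g, h1, rfl, h2⟩ := h₁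
  obtain ⟨k, h3, rfl, h4⟩ := h₂
  exact ⟨fun y => g y + k y, (h1.and h3).mono fun y hy => hy.1.fun_add hy.2, rfl, h2.fun_add h4⟩

theorem sub (h₁ : HasSecondDeriv f₁ a₁ b₁ t) (h₂ : HasSecondDeriv f₂ a₂ b₂ t) :
    HasSecondDeriv (fun y => f₁ y - f₂ y) (a₁ - a₂) (b₁ - b₂) t := by
  simpa only [sub_eq_add_neg] using h₁.add h₂.neg

theorem const_mul (c : ℝ) (h : HasSecondDeriv f a b t) :
    HasSecondDeriv (fun y => c * f y) (c * a) (c * b) t := by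
  obtain ⟨g, h1, rfl, h2⟩ := h
  exact ⟨fun y => c * g y, h1.mono fun y hy => hy.const_mul c, rfl, h2.const_mul c⟩

theorem comp_neg (h : HasSecondDeriv f a b (-t)) :
    HasSecondDeriv (fun y => f (-y)) (-a) b t := by
  obtain ⟨g, h1, rfl, h2⟩ := h
  refine ⟨fun y => -g (-y), ?_, rfl, ?_⟩
  · have := (continuous_neg.tendsto t).eventually h1
    filter_upwards [this] with y hy
    refine (HasDerivAt.comp y hy (hasDerivAt_neg y)).congr_deriv ?_
    ring
  · refine (HasDerivAt.comp t h2 (hasDerivAt_neg t)).fun_neg.congr_deriv ?_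
    ring

theorem comp_const_add {z : ℝ} (h : HasSecondDeriv f a b z) :
    HasSecondDeriv (fun y => f (z + y)) a b 0 := by
  obtain ⟨g, h1, rfl, h2⟩ := h
  refine ⟨fun y => g (z + y), ?_, by simp, HasDerivAt.comp_const_add z 0 (by simpa using h2)⟩
  have : Tendsto (fun y => z + y) (𝓝 0) (𝓝 z) := by
    simpa using (continuous_const_add z).tendsto 0
  filter_upwards [this.eventually h1] with y hy using HasDerivAt.comp_const_add z y hy

theorem congr (h : HasSecondDeriv f₁ a b t) (hf : ∀ y, f₂ y = f₁ y) :
    HasSecondDeriv f₂ a b t := (funext hf : f₂ = f₁) ▸ h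

/-- The Taylor polynomial `c + a y + b y² / 2`, centred at `0`, has the expected derivatives. -/
theorem quadratic (c a b : ℝ) : HasSecondDeriv (fun y => c + a * y + b / 2 * y ^ 2) a b 0 := by
  refine ⟨fun y => a + b * y, .of_forall fun y => ?_, by simp, ?_⟩
  · refine ((((hasDerivAt_id' y).const_mul a).const_add c).fun_add
      (((hasDerivAt_id' y).fun_pow 2).const_mul (b / 2))).congr_deriv ?_
    simp; ring
  · simpa using ((hasDerivAt_id (0 : ℝ)).const_mul b).const_add a

theorem sq (h : HasSecondDeriv f a b t) :
    HasSecondDeriv (fun y => f y ^ 2) (2 * f t * a) (2 * a ^ 2 + 2 * f t * b) t := by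
  have h0 := h.hasDerivAt
  obtain ⟨g, h1, rfl, h2⟩ := h
  refine ⟨fun y => 2 * f y * g y, ?_, rfl, ?_⟩
  · filter_upwards [h1] with y hy
    simpa using hy.fun_pow 2
  · refine ((h0.const_mul 2).fun_mul h2).congr_deriv ?_
    ring

theorem rpow {z : ℝ} (hz : 0 < z) (p : ℝ) :
    HasSecondDeriv (fun y => y ^ p) (p * z ^ p / z) (p * (p - 1) * z ^ p / z ^ 2) z := by
  refine ⟨fun y => p * y ^ (p - 1), ?_, ?_, ?_⟩
  · filter_upwards [lt_mem_nhds hz] with y hy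
    exact Real.hasDerivAt_rpow_const (Or.inl hy.ne')
  · simp only [Real.rpow_sub_one hz.ne']; ring
  · refine ((Real.hasDerivAt_rpow_const (p := p - 1) (Or.inl hz.ne')).const_mul p).congr_deriv ?_
    simp only [Real.rpow_sub_one hz.ne']; field_simp

theorem of_isLocalMax (h : HasSecondDeriv f a b t) (hm : IsLocalMax f t) : a = 0 ∧ b ≤ 0 := by
  have ha : a = 0 := hm.hasDerivAt_eq_zero h.hasDerivAt
  refine ⟨ha, ?_⟩
  by_contra! hb
  have hf := h.hasDerivAt
  obtain ⟨g, h1, rfl, h2⟩ := h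
  have he : deriv f =ᶠ[𝓝 t] g := h1.mono fun y hy => hy.deriv
  have hd : deriv (deriv f) t = b := by rw [he.deriv_eq, h2.deriv]
  have hmin := isLocalMin_of_deriv_deriv_pos (hd ▸ hb) (by rw [hf.deriv, ha]) hf.continuousAt
  have hc : f =ᶠ[𝓝 t] fun _ => f t := by
    filter_upwards [hm, hmin] with y h3 h4 using le_antisymm h3 h4
  have : deriv f =ᶠ[𝓝 t] fun _ => 0 := by
    filter_upwards [hc.eventuallyEq_nhds] with y hy
    rw [hy.deriv_eq]; simp
  rw [this.deriv_eq] at hd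
  simp at hd
  linarith

/-- Comparison of derivatives at a local maximum of a difference. -/
theorem eq_and_le_of_isLocalMax (h₁ : HasSecondDeriv f₁ a₁ b₁ t) (h₂ : HasSecondDeriv f₂ a₂ b₂ t)
    (hm : IsLocalMax (fun y => f₁ y - f₂ y) t) : a₁ = a₂ ∧ b₁ ≤ b₂ := by
  obtain ⟨h, h'⟩ := (h₁.sub h₂).of_isLocalMax hm
  exact ⟨sub_eq_zero.1 h, sub_nonpos.1 h'⟩

end HasSecondDeriv

theorem two_mul_le_of_symm_diff_le {f : ℝ → ℝ} {a t k l r : ℝ} (hr : 0 < r)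
    (hf : HasDerivAt f a t)
    (h : ∀ y, 0 ≤ y → y ≤ r → f (t + y) - f (t - y) ≤ k * y + l * y ^ 2) : 2 * a ≤ k := by
  have h1 : HasDerivAt (fun y => f (t + y) - f (t - y) - (k * y + l * y ^ 2)) (2 * a - k) 0 := by
    have e1 : HasDerivAt (fun y => f (t + y)) a 0 :=
      HasDerivAt.comp_const_add t 0 (by simpa using hf)
    have e2 : HasDerivAt (fun y => f (t - y)) (-a) 0 :=
      HasDerivAt.comp_const_sub t 0 (by simpa using hf)
    refine ((e1.fun_sub e2).fun_sub (((hasDerivAt_id' (0 : ℝ)).const_mul k).fun_add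
      (((hasDerivAt_id' (0 : ℝ)).fun_pow 2).const_mul l))).congr_deriv ?_
    simp; ring
  have h2 := (hasDerivAt_iff_tendsto_slope_zero.1 h1).mono_left
    (nhdsWithin_mono 0 (fun y (hy : 0 < y) => hy.ne') : 𝓝[>] (0 : ℝ) ≤ _)
  have h3 : 2 * a - k ≤ 0 := by
    refine le_of_tendsto h2 ?_
    filter_upwards [Ioc_mem_nhdsGT hr] with y hy
    simp only [zero_add, smul_eq_mul]
    refine mul_nonpos_of_nonneg_of_nonpos (inv_nonneg.2 hy.1.le) ?_
    have := h y hy.1.le hy.2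
    simp
    linarith
  linarith

/-- `U` has second pure partial derivatives at `(x, z)`, and these satisfy
`Δ_x U + ∂_{zz} U + ((1 - s) / z) ∂_z U = 0`. -/
def SolvesAt {n : ℕ} (s : ℝ) (U : EuclideanSpace ℝ (Fin n) → ℝ → ℝ)
    (x : EuclideanSpace ℝ (Fin n)) (z : ℝ) : Prop :=
  ∃ (a b : Fin n → ℝ) (c d : ℝ),
    (∀ j, HasSecondDeriv (fun t => U (x + t • EuclideanSpace.single j (1 : ℝ)) z)
      (a j) (b j) 0) ∧
    HasSecondDeriv (U x) c d z ∧ (∑ j, b j) + d + (1 - s) / z * c = 0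

theorem SolvesAt.neg {n : ℕ} {s : ℝ} {U : EuclideanSpace ℝ (Fin n) → ℝ → ℝ}
    {x : EuclideanSpace ℝ (Fin n)} {z : ℝ} (h : SolvesAt s U x z) :
    SolvesAt s (fun x z => -U x z) x z := by
  obtain ⟨a, b, c, d, h1, h2, h3⟩ := h
  refine ⟨_, _, _, _, fun j => (h1 j).neg, h2.neg, ?_⟩
  rw [Finset.sum_neg_distrib]
  linarith

theorem norm_add_smul_single_sq {n : ℕ} (y : EuclideanSpace ℝ (Fin n)) (j : Fin n) (t : ℝ) :
    ‖y + t • EuclideanSpace.single j (1 : ℝ)‖ ^ 2 = ‖y‖ ^ 2 + 2 * y j * t + 2 / 2 * t ^ 2 := by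
  rw [norm_add_sq_real, norm_smul, inner_smul_right]
  simp [EuclideanSpace.inner_single_right]
  ring

theorem HasSecondDeriv.const (c t : ℝ) : HasSecondDeriv (fun _ => c) 0 0 t :=
  ⟨fun _ => 0, .of_forall fun y => hasDerivAt_const y c, rfl, hasDerivAt_const t 0⟩

theorem HasSecondDeriv.norm_sq_line {n : ℕ} (y : EuclideanSpace ℝ (Fin n)) (j : Fin n) :
    HasSecondDeriv (fun t : ℝ => ‖y + t • EuclideanSpace.single j (1 : ℝ)‖ ^ 2) (2 * y j) 2 0 :=
  (HasSecondDeriv.quadratic (‖y‖ ^ 2) (2 * y j) 2).congr fun t => norm_add_smul_single_sq y j t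

/-- Barrier for the boundary decay; `q` stands for the squared tangential distance. -/
noncomputable def decayBarrier (a K s q z : ℝ) : ℝ :=
  q ^ 2 + a * z ^ (s / 2) * q + K * (2 * z ^ s - z ^ (s + 1))

theorem rpow_eq_half_sq {s z : ℝ} (hz : 0 < z) : z ^ s = (z ^ (s / 2)) ^ 2 := by
  rw [← Real.rpow_natCast, ← Real.rpow_mul hz.le]
  congr 1; push_cast; ring

theorem self_le_rpow_half {s z : ℝ} (hs : s ≤ 2) (hz : 0 < z) (hz1 : z ≤ 1) : z ≤ z ^ (s / 2) := by
  simpa using Real.rpow_le_rpow_of_exponent_ge hz hz1 (by linarith : s / 2 ≤ 1)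

theorem hasSecondDeriv_decayBarrier_tangential {n : ℕ} (a K s z : ℝ)
    (y : EuclideanSpace ℝ (Fin n)) (j : Fin n) :
    HasSecondDeriv
      (fun t : ℝ => decayBarrier a K s (‖y + t • EuclideanSpace.single j (1 : ℝ)‖ ^ 2) z)
      (4 * ‖y‖ ^ 2 * y j + 2 * a * z ^ (s / 2) * y j)
      (8 * y j ^ 2 + 4 * ‖y‖ ^ 2 + 2 * a * z ^ (s / 2)) 0 := by
  have h := HasSecondDeriv.norm_sq_line y j
  refine ((h.sq.add (h.const_mul (a * z ^ (s / 2)))).add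
    (HasSecondDeriv.const (K * (2 * z ^ s - z ^ (s + 1))) 0)).congr_coeff ?_ ?_
  · simp; ring
  · simp; ring

theorem hasSecondDeriv_decayBarrier_normal {a K s q z : ℝ} (hz : 0 < z) :
    HasSecondDeriv (decayBarrier a K s q)
      (a * q * (s / 2 * z ^ (s / 2) / z)
        + K * (2 * (s * z ^ s / z) - (s + 1) * z ^ (s + 1) / z))
      (a * q * (s / 2 * (s / 2 - 1) * z ^ (s / 2) / z ^ 2)
        + K * (2 * (s * (s - 1) * z ^ s / z ^ 2) - (s + 1) * (s + 1 - 1) * z ^ (s + 1) / z ^ 2))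
      z := by
  refine ((((HasSecondDeriv.const (q ^ 2) z).add
    ((HasSecondDeriv.rpow hz (s / 2)).const_mul (a * q))).add
    ((((HasSecondDeriv.rpow hz s).const_mul 2).sub
      (HasSecondDeriv.rpow hz (s + 1))).const_mul K)).congr ?_).congr_coeff ?_ ?_
  · intro y; unfold decayBarrier; ring
  · ring
  · ring

/-- The barrier is a strict supersolution of the extension equation. -/
theorem exists_decayBarrier_strict_supersolution (n : ℕ) {s : ℝ} (hs : s ∈ Ioo (0 : ℝ) 2) :
    ∃ a : ℝ, 0 ≤ a ∧ ∀ q z P : ℝ, 0 ≤ q → q ≤ 1 → 0 < z → z ≤ 1 → P = z ^ (s / 2) →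
      4 * (n + 2) * q + 2 * n * a * P
        + a * q * (s / 2 * (s / 2 - 1) * P / z ^ 2)
        + 32 * (n + 2) ^ 2 * (2 * (s * (s - 1) * P ^ 2 / z ^ 2)
          - (s + 1) * (s + 1 - 1) * (P ^ 2 * z) / z ^ 2)
        + (1 - s) / z * (a * q * (s / 2 * P / z)
          + 32 * (n + 2) ^ 2 * (2 * (s * P ^ 2 / z) - (s + 1) * (P ^ 2 * z) / z)) < 0 := by
  obtain ⟨hs0, hs2⟩ := hs
  have hn : (0 : ℝ) ≤ n := n.cast_nonneg
  have key : ∀ a q z P : ℝ, 0 < z → 4 * (n + 2) * q + 2 * n * a * P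
        + a * q * (s / 2 * (s / 2 - 1) * P / z ^ 2)
        + 32 * (n + 2) ^ 2 * (2 * (s * (s - 1) * P ^ 2 / z ^ 2)
          - (s + 1) * (s + 1 - 1) * (P ^ 2 * z) / z ^ 2)
        + (1 - s) / z * (a * q * (s / 2 * P / z)
          + 32 * (n + 2) ^ 2 * (2 * (s * P ^ 2 / z) - (s + 1) * (P ^ 2 * z) / z))
      = 4 * (n + 2) * q + 2 * n * a * P - a * q * (s ^ 2 / 4) * (P / z ^ 2)
        - 32 * (n + 2) ^ 2 * (s + 1) * (P ^ 2 / z) := by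
    intro a q z P hz
    field_simp
    ring
  rcases le_or_gt s 1 with h1 | h1
  · refine ⟨0, le_rfl, fun q z P hq hq1 hz hz1 hP => ?_⟩
    rw [key _ _ _ _ hz]
    have hPz : 1 ≤ P ^ 2 / z := by
      rw [one_le_div hz, hP, ← rpow_eq_half_sq hz]
      simpa using Real.rpow_le_rpow_of_exponent_ge hz hz1 h1
    have h2 : (1 : ℝ) * 1 ≤ (s + 1) * (P ^ 2 / z) :=
      mul_le_mul (by linarith) hPz zero_le_one (by linarith)
    nlinarith [mul_le_mul_of_nonneg_left h2 (by positivity : (0 : ℝ) ≤ 32 * (n + 2) ^ 2)]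
  · refine ⟨16 * (n + 2), by positivity, fun q z P hq hq1 hz hz1 hP => ?_⟩
    rw [key _ _ _ _ hz]
    have hPz : z ≤ P := hP ▸ self_le_rpow_half hs2.le hz hz1
    have hP0 : 0 < P := hz.trans_le hPz
    have h2 : 1 ≤ P / z ^ 2 := by
      rw [one_le_div (by positivity)]; nlinarith
    have h3 : P ≤ P ^ 2 / z := by
      rw [le_div_iff₀ hz]; nlinarith
    have h4 : (1 / 4 : ℝ) * 1 ≤ (s ^ 2 / 4) * (P / z ^ 2) :=
      mul_le_mul (by nlinarith) h2 zero_le_one (by positivity)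
    have h5 : 1 * P ≤ (s + 1) * (P ^ 2 / z) :=
      mul_le_mul (by linarith) h3 hP0.le (by linarith)
    have h6 := mul_le_mul_of_nonneg_left h4 (by positivity : (0 : ℝ) ≤ 16 * (n + 2) * q)
    have h7 := mul_le_mul_of_nonneg_left h5 (by positivity : (0 : ℝ) ≤ 32 * (n + 2) ^ 2)
    have h8 : 0 < (n + 2) * P := by positivity
    nlinarith

/-- A subsolution bounded by `M` near a boundary point with vanishing trace decays like `z ^ s`. -/
theorem le_mul_rpow_of_trace_eq_zero {n : ℕ} {s ρ M : ℝ} (hs : s ∈ Ioo (0 : ℝ) 2)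
    {U : EuclideanSpace ℝ (Fin n) → ℝ → ℝ} {x₀ : EuclideanSpace ℝ (Fin n)}
    (hρ : 0 < ρ) (hρ1 : ρ ≤ 1) (hM : 0 < M)
    (hc : ContinuousOn (fun p : EuclideanSpace ℝ (Fin n) × ℝ => U p.1 p.2)
      (Metric.closedBall x₀ ρ ×ˢ Icc 0 ρ))
    (hU : ∀ x z, ‖x - x₀‖ < ρ → 0 < z → z < ρ → SolvesAt s U x z)
    (h0 : ∀ x, ‖x - x₀‖ ≤ ρ → U x 0 = 0)
    (hb : ∀ x z, ‖x - x₀‖ ≤ ρ → 0 < z → z ≤ ρ → U x z ≤ M)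
    {z : ℝ} (hz : 0 < z) (hzρ : z ≤ ρ) :
    U x₀ z ≤ M / ρ ^ 4 * (64 * (n + 2) ^ 2) * z ^ s := by
  obtain ⟨a, ha, hsup⟩ := exists_decayBarrier_strict_supersolution n hs
  obtain ⟨hs0, hs2⟩ := hs
  set K : ℝ := 32 * (n + 2) ^ 2 with hK
  have hn : (0 : ℝ) ≤ n := n.cast_nonneg
  have hK1 : 1 ≤ K := by nlinarith
  set κ := M / ρ ^ 4 with hκ
  have hκ0 : 0 < κ := by positivity
  have hκM : κ * ρ ^ 4 = M := by rw [hκ]; field_simp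
  set W : EuclideanSpace ℝ (Fin n) × ℝ → ℝ :=
    fun p => U p.1 p.2 - κ * decayBarrier a K s (‖p.1 - x₀‖ ^ 2) p.2 with hW
  have hrc : ∀ p : ℝ, 0 ≤ p → Continuous fun q : EuclideanSpace ℝ (Fin n) × ℝ => q.2 ^ p :=
    fun p hp => continuous_snd.rpow_const fun _ => Or.inr hp
  have hWc : ContinuousOn W (Metric.closedBall x₀ ρ ×ˢ Icc 0 ρ) := by
    refine hc.sub (Continuous.continuousOn ?_)
    unfold decayBarrier
    have e1 := hrc (s / 2) (by linarith)
    have e2 := hrc s hs0.le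
    have e3 := hrc (s + 1) (by linarith)
    fun_prop
  obtain ⟨⟨x, w⟩, ⟨hx, hw⟩, hmax⟩ :=
    ((isCompact_closedBall x₀ ρ).prod isCompact_Icc).exists_isMaxOn
      ⟨(x₀, z), Metric.mem_closedBall_self hρ.le, hz.le, hzρ⟩ hWc
  simp only [Metric.mem_closedBall, dist_eq_norm] at hx
  simp only [mem_Icc] at hw
  have hpos : ∀ q v : ℝ, 0 ≤ q → 0 < v → v ≤ 1 →
      q ^ 2 ≤ decayBarrier a K s q v ∧ v ^ 2 ≤ decayBarrier a K s q v := by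
    intro q v hq hv hv1
    unfold decayBarrier
    rw [Real.rpow_add hv, Real.rpow_one, rpow_eq_half_sq (s := s) hv]
    have hvP := self_le_rpow_half hs2.le hv hv1
    set P := v ^ (s / 2)
    have hP : 0 < P := hv.trans_le hvP
    have e1 : 0 ≤ a * P * q := by positivity
    have e2 : P ^ 2 ≤ 2 * P ^ 2 - P ^ 2 * v := by nlinarith [sq_nonneg P]
    have e3 : 1 * P ^ 2 ≤ K * (2 * P ^ 2 - P ^ 2 * v) :=
      mul_le_mul hK1 e2 (sq_nonneg P) (by linarith)
    constructor <;> nlinarith [sq_nonneg P, sq_nonneg q]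
  have hle : W (x, w) ≤ 0 := by
    by_contra! hcon
    simp only [hW] at hcon
    have hw0 : 0 < w := by
      refine hw.1.lt_of_ne fun h => ?_
      subst h
      rw [h0 x hx] at hcon
      unfold decayBarrier at hcon
      rw [Real.zero_rpow (by positivity), Real.zero_rpow hs0.ne', Real.zero_rpow (by linarith)]
        at hcon
      have : 0 ≤ κ * (‖x - x₀‖ ^ 2) ^ 2 := by positivity
      linarith
    have hU' := hb x w hx hw0 hw.2
    obtain ⟨p1, p2⟩ := hpos (‖x - x₀‖ ^ 2) w (by positivity) hw0 (hw.2.trans hρ1)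
    have hx' : ‖x - x₀‖ < ρ := by
      refine hx.lt_of_ne fun h => ?_
      have := mul_le_mul_of_nonneg_left p1 hκ0.le
      rw [h] at this hcon
      nlinarith
    have hw' : w < ρ := by
      refine hw.2.lt_of_ne fun h => ?_
      have := mul_le_mul_of_nonneg_left p2 hκ0.le
      rw [h] at this hcon hU'
      have : κ * ρ ^ 4 ≤ κ * ρ ^ 2 :=
        mul_le_mul_of_nonneg_left (pow_le_pow_of_le_one hρ.le hρ1 (by norm_num)) hκ0.le
      linarith
    have hloc : IsLocalMax W (x, w) := hmax.isLocalMax (prod_mem_nhds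
      (Metric.closedBall_mem_nhds_of_mem (by simpa [dist_eq_norm] using hx'))
      (Icc_mem_nhds hw0 hw'))
    obtain ⟨α, β, c, d, hα, hcd, heq⟩ := hU x w hx' hw0 hw'
    have htan : ∀ j, β j ≤
        κ * (8 * (x - x₀) j ^ 2 + 4 * ‖x - x₀‖ ^ 2 + 2 * a * w ^ (s / 2)) := by
      intro j
      refine ((hα j).eq_and_le_of_isLocalMax
        ((hasSecondDeriv_decayBarrier_tangential a K s w (x - x₀) j).const_mul κ) ?_).2
      have := IsLocalMax.comp_continuous (f := W)
        (g := fun t : ℝ => (x + t • EuclideanSpace.single j (1 : ℝ), w)) (b := 0)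
        (by simpa using hloc) (by fun_prop)
      simpa only [hW, Function.comp_def, add_sub_right_comm] using this
    obtain ⟨hc1, hc2⟩ := hcd.eq_and_le_of_isLocalMax
      ((hasSecondDeriv_decayBarrier_normal (a := a) (K := K) (s := s) (q := ‖x - x₀‖ ^ 2)
        hw0).const_mul κ)
      (IsLocalMax.comp_continuous (f := W) (g := fun t : ℝ => (x, t)) hloc (by fun_prop))
    have hsum := Finset.sum_le_sum fun j (_ : j ∈ Finset.univ) => htan j
    rw [← Finset.mul_sum, Finset.sum_add_distrib, Finset.sum_add_distrib, ← Finset.mul_sum,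
      ← EuclideanSpace.real_norm_sq_eq] at hsum
    simp only [Finset.sum_const, Finset.card_univ, Fintype.card_fin, nsmul_eq_mul] at hsum
    have hfin := hsup (‖x - x₀‖ ^ 2) w _ (by positivity)
      (pow_le_one₀ (norm_nonneg _) (hx.trans hρ1)) hw0 (hw.2.trans hρ1) rfl
    rw [← rpow_eq_half_sq hw0, ← Real.rpow_add_one hw0.ne'] at hfin
    have := mul_neg_of_pos_of_neg hκ0 hfin
    rw [hc1] at heq
    nlinarith
  have hfin := (hmax ⟨Metric.mem_closedBall_self hρ.le, hz.le, hzρ⟩ : W (x₀, z) ≤ W (x, w)).trans hle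
  simp only [hW, decayBarrier, sub_self, norm_zero] at hfin
  have h1 : 0 ≤ κ * K * z ^ (s + 1) := by positivity
  have h2 : (64 * (n + 2) ^ 2 : ℝ) = 2 * K := by rw [hK]; ring
  rw [h2]
  nlinarith

theorem abs_drift_le {s r z : ℝ} (hs : s ∈ Ioo (0 : ℝ) 2) (hr : 0 < r) (hz : 39 * r ≤ z) :
    |(1 - s) / z| ≤ 1 / (39 * r) := by
  have hz0 : 0 < z := by linarith
  rw [abs_div, abs_of_pos hz0]
  exact div_le_div₀ zero_le_one (abs_le.2 ⟨by linarith [hs.2], by linarith [hs.1]⟩)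
    (by linarith) hz

theorem drift_mul_le {s r z y : ℝ} (hs : s ∈ Ioo (0 : ℝ) 2) (hr : 0 < r) (hz : 39 * r ≤ z)
    (hy : |y| ≤ r) : (1 - s) / z * y ≤ 1 / 39 := by
  refine (le_abs_self _).trans ?_
  rw [abs_mul]
  refine (mul_le_mul (abs_drift_le hs hr hz) hy (abs_nonneg _) (by positivity)).trans_eq ?_
  field_simp

theorem drift_sub_mul_le {s r z w y c : ℝ} (hs : s ∈ Ioo (0 : ℝ) 2) (hr : 0 < r)
    (hz : 39 * r ≤ z) (hw : 39 * r ≤ w) (hzw : |w - z| ≤ 2 * r) (hy : |y| ≤ c * r) :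
    ((1 - s) / z - (1 - s) / w) * y ≤ 2 * c / 1521 := by
  have hz0 : 0 < z := by linarith
  have hw0 : 0 < w := by linarith
  refine (le_abs_self _).trans ?_
  have e : ((1 - s) / z - (1 - s) / w) * y = (1 - s) / z * ((w - z) / w * y) := by
    field_simp
  rw [e, abs_mul, abs_mul, abs_div (w - z), abs_of_pos hw0]
  have h2 : |w - z| / w ≤ 2 * r / (39 * r) := div_le_div₀ (by positivity) hzw (by positivity) hw
  have h3 := mul_le_mul h2 hy (abs_nonneg _) (by positivity)
  refine (mul_le_mul (abs_drift_le hs hr hz) h3 (by positivity) (by positivity)).trans_eq ?_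
  field_simp
  norm_num
  ring

theorem tangential_difference_le {n : ℕ} {s r z₀ M : ℝ} (hs : s ∈ Ioo (0 : ℝ) 2)
    {U : EuclideanSpace ℝ (Fin n) → ℝ → ℝ} {x₀ : EuclideanSpace ℝ (Fin n)}
    (hr : 0 < r) (hz₀ : z₀ = 40 * r) (hM : 0 < M)
    (hc : ContinuousOn (fun p : EuclideanSpace ℝ (Fin n) × ℝ => U p.1 p.2)
      (Metric.closedBall x₀ (2 * r) ×ˢ Icc (z₀ - r) (z₀ + r)))
    (hU : ∀ x z, ‖x - x₀‖ ≤ 2 * r → z₀ - r ≤ z → z ≤ z₀ + r → SolvesAt s U x z)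
    (hb : ∀ x z, ‖x - x₀‖ ≤ 2 * r → z₀ - r ≤ z → z ≤ z₀ + r → |U x z| ≤ M)
    (i : Fin n) {t : ℝ} (ht : 0 ≤ t) (htr : t ≤ r) :
    U (x₀ + t • EuclideanSpace.single i (1 : ℝ)) z₀
      - U (x₀ - t • EuclideanSpace.single i (1 : ℝ)) z₀ ≤ 2 * (n + 2) * M / r * t := by
  have hn : (0 : ℝ) ≤ n := n.cast_nonneg
  set e : EuclideanSpace ℝ (Fin n) := EuclideanSpace.single i (1 : ℝ) with he
  have he1 : ‖e‖ = 1 := by simp [he]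
  set α : ℝ := 2 * M / r ^ 2 with hα
  have hα0 : 0 < α := by positivity
  have hαM : α * r ^ 2 = 2 * M := by rw [hα]; field_simp
  set β : ℝ := (n + 2) * α * r with hβ
  set γ : ℝ := (n + 1) * α with hγ
  have hγ0 : 0 < γ := by positivity
  set W : EuclideanSpace ℝ (Fin n) × ℝ × ℝ → ℝ := fun p =>
    (U (p.1 + p.2.2 • e) p.2.1 - U (p.1 - p.2.2 • e) p.2.1)
      - (α * (‖p.1 - x₀‖ ^ 2 + (p.2.1 - z₀) ^ 2) + (β * p.2.2 - γ * p.2.2 ^ 2)) with hW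
  have hmove : ∀ x : EuclideanSpace ℝ (Fin n), ∀ h, ‖x - x₀‖ ≤ r → 0 ≤ h → h ≤ r →
      ‖x + h • e - x₀‖ ≤ 2 * r ∧ ‖x - h • e - x₀‖ ≤ 2 * r := by
    intro x h hx h0 hh
    have e1 : ‖h • e‖ ≤ r := by rw [norm_smul, he1, mul_one, Real.norm_of_nonneg h0]; exact hh
    constructor
    · rw [add_sub_right_comm]; linarith [norm_add_le (x - x₀) (h • e)]
    · rw [sub_right_comm]; linarith [norm_sub_le (x - x₀) (h • e)]
  have hWc : ContinuousOn W
      (Metric.closedBall x₀ r ×ˢ Icc (z₀ - r) (z₀ + r) ×ˢ Icc 0 r) := by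
    refine ContinuousOn.sub (ContinuousOn.sub ?_ ?_) (Continuous.continuousOn (by fun_prop))
    · refine hc.comp (f := fun p : EuclideanSpace ℝ (Fin n) × ℝ × ℝ =>
        (p.1 + p.2.2 • e, p.2.1)) (Continuous.continuousOn (by fun_prop)) ?_
      rintro ⟨x, z, h⟩ ⟨hx, hz, hh⟩
      exact ⟨by simpa [dist_eq_norm] using
        (hmove x h (by simpa [dist_eq_norm] using hx) hh.1 hh.2).1, hz⟩
    · refine hc.comp (f := fun p : EuclideanSpace ℝ (Fin n) × ℝ × ℝ =>
        (p.1 - p.2.2 • e, p.2.1)) (Continuous.continuousOn (by fun_prop)) ?_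
      rintro ⟨x, z, h⟩ ⟨hx, hz, hh⟩
      exact ⟨by simpa [dist_eq_norm] using
        (hmove x h (by simpa [dist_eq_norm] using hx) hh.1 hh.2).2, hz⟩
  have hmem : (x₀, z₀, t) ∈ Metric.closedBall x₀ r ×ˢ Icc (z₀ - r) (z₀ + r) ×ˢ Icc 0 r :=
    ⟨Metric.mem_closedBall_self hr.le, ⟨by linarith, by linarith⟩, ht, htr⟩
  obtain ⟨⟨x, z, h⟩, ⟨hx, hz, hh⟩, hmax⟩ :=
    ((isCompact_closedBall x₀ r).prod (isCompact_Icc.prod isCompact_Icc)).exists_isMaxOn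
      ⟨_, hmem⟩ hWc
  simp only [Metric.mem_closedBall, dist_eq_norm] at hx
  simp only [mem_Icc] at hz hh
  have hle : W (x, z, h) ≤ 0 := by
    by_contra! hcon
    simp only [hW] at hcon
    obtain ⟨hp, hq⟩ := hmove x h hx hh.1 hh.2
    have hp' := abs_le.1 (hb _ z hp hz.1 hz.2)
    have hq' := abs_le.1 (hb _ z hq hz.1 hz.2)
    have hβγ : 0 ≤ β * h - γ * h ^ 2 := by
      have : β * h - γ * h ^ 2 = α * h * ((n + 1) * (r - h) + r) := by rw [hβ, hγ]; ring
      rw [this]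
      have : 0 ≤ (n + 1) * (r - h) := mul_nonneg (by linarith) (by linarith [hh.2])
      exact mul_nonneg (mul_nonneg hα0.le hh.1) (by linarith)
    have hh0 : 0 < h := by
      refine hh.1.lt_of_ne fun h' => ?_
      subst h'
      have : 0 ≤ α * (‖x - x₀‖ ^ 2 + (z - z₀) ^ 2) := by positivity
      simp at hcon
      linarith
    have hhr : h < r := by
      refine hh.2.lt_of_ne fun h' => ?_
      have : 0 ≤ α * (‖x - x₀‖ ^ 2 + (z - z₀) ^ 2) := by positivity
      have : β * h - γ * h ^ 2 = α * r ^ 2 := by rw [hβ, hγ, h']; ring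
      linarith
    have hlat : ‖x - x₀‖ ^ 2 + (z - z₀) ^ 2 < r ^ 2 := by
      by_contra! h'
      have := mul_le_mul_of_nonneg_left h' hα0.le
      linarith
    have hx' : ‖x - x₀‖ < r := lt_of_pow_lt_pow_left₀ 2 hr.le (by nlinarith)
    have hz' : |z - z₀| < r := abs_lt_of_sq_lt_sq (by nlinarith [sq_nonneg ‖x - x₀‖]) hr.le
    have hloc : IsLocalMax W (x, z, h) := hmax.isLocalMax (prod_mem_nhds
      (Metric.closedBall_mem_nhds_of_mem (by simpa [dist_eq_norm] using hx'))
      (prod_mem_nhds (Icc_mem_nhds (by linarith [(abs_lt.1 hz').1])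
        (by linarith [(abs_lt.1 hz').2])) (Icc_mem_nhds hh0 hhr)))
    obtain ⟨a₁, b₁, c₁, d₁, ha₁, hcd₁, heq₁⟩ := hU _ z hp hz.1 hz.2
    obtain ⟨a₂, b₂, c₂, d₂, ha₂, hcd₂, heq₂⟩ := hU _ z hq hz.1 hz.2
    have htan : ∀ j, b₁ j - b₂ j ≤ α * 2 := by
      intro j
      have hbar := ((((HasSecondDeriv.norm_sq_line (x - x₀) j).add
        (HasSecondDeriv.const ((z - z₀) ^ 2) 0)).const_mul α).add
          (HasSecondDeriv.const (β * h - γ * h ^ 2) 0))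
      have := (((ha₁ j).sub (ha₂ j)).eq_and_le_of_isLocalMax hbar ?_).2
      · simpa using this
      · have := IsLocalMax.comp_continuous (f := W)
          (g := fun t : ℝ => (x + t • EuclideanSpace.single j (1 : ℝ), z, h)) (b := 0)
          (by simpa using hloc) (by fun_prop)
        simpa only [hW, Function.comp_def, add_sub_right_comm, add_right_comm] using this
    have hdir : b₁ i - b₂ i ≤ -(2 * γ) := by
      have hbar := (HasSecondDeriv.const (α * (‖x - x₀‖ ^ 2 + (z - z₀) ^ 2)) 0).add
        (HasSecondDeriv.quadratic (β * h - γ * h ^ 2) (β - 2 * γ * h) (-(2 * γ)))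
      have h2 : HasSecondDeriv (fun t => U (x - h • e + (-t) • e) z) _ _ 0 :=
        HasSecondDeriv.comp_neg (t := 0) (by rw [neg_zero]; exact ha₂ i)
      have := (((ha₁ i).sub h2).eq_and_le_of_isLocalMax hbar ?_).2
      · simpa using this
      · have := IsLocalMax.comp_continuous (f := W)
          (g := fun t : ℝ => (x, z, h + t)) (b := 0) (by simpa using hloc) (by fun_prop)
        convert this using 2 with y
        simp only [hW, Function.comp_def]
        congr 1
        · congr 2
          · module
          · module
        · ring
    have hnor : c₁ - c₂ = α * (2 * (z - z₀)) ∧ d₁ - d₂ ≤ α * 2 := by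
      have hbar := (((HasSecondDeriv.const (‖x - x₀‖ ^ 2) 0).add
        (HasSecondDeriv.quadratic ((z - z₀) ^ 2) (2 * (z - z₀)) 2)).const_mul α).add
          (HasSecondDeriv.const (β * h - γ * h ^ 2) 0)
      have hsh := hcd₁.sub hcd₂
      have := (hsh.comp_const_add).eq_and_le_of_isLocalMax hbar ?_
      · simpa using this
      · have := IsLocalMax.comp_continuous (f := W)
          (g := fun t : ℝ => (x, z + t, h)) (b := 0) (by simpa using hloc) (by fun_prop)
        convert this using 2 with y
        simp only [hW, Function.comp_def]
        congr 1
        ring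
    have hsum : ∑ j, (b₁ j - b₂ j) ≤ ∑ j, (α * 2 - if j = i then α * 2 + 2 * γ else 0) := by
      refine Finset.sum_le_sum fun j _ => ?_
      split_ifs with hj
      · subst hj; linarith
      · linarith [htan j]
    rw [Finset.sum_sub_distrib, Finset.sum_sub_distrib] at hsum
    simp at hsum
    have hdr := mul_le_mul_of_nonneg_left (drift_mul_le hs hr (by linarith : 39 * r ≤ z) hz'.le)
      hα0.le
    have hdr' : (1 - s) / z * c₁ - (1 - s) / z * c₂ = 2 * (α * ((1 - s) / z * (z - z₀))) := by
      rw [← mul_sub, hnor.1]; ring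
    have : γ = n * α + α := by rw [hγ]; ring
    linarith [hnor.2]
  have hfin := (hmax hmem : W (x₀, z₀, t) ≤ W (x, z, h)).trans hle
  simp only [hW, sub_self, norm_zero] at hfin
  have h1 : 0 ≤ γ * t ^ 2 := by positivity
  have h2 : 2 * (n + 2) * M / r = β := by rw [hβ, hα]; field_simp
  rw [h2]
  linarith

theorem normal_difference_le {n : ℕ} {s r z₀ M : ℝ} (hs : s ∈ Ioo (0 : ℝ) 2)
    {U : EuclideanSpace ℝ (Fin n) → ℝ → ℝ} {x₀ : EuclideanSpace ℝ (Fin n)}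
    (hr : 0 < r) (hz₀ : z₀ = 40 * r) (hM : 0 < M)
    (hc : ContinuousOn (fun p : EuclideanSpace ℝ (Fin n) × ℝ => U p.1 p.2)
      (Metric.closedBall x₀ r ×ˢ Icc (z₀ - r) (z₀ + r)))
    (hU : ∀ x z, ‖x - x₀‖ ≤ r → z₀ - r ≤ z → z ≤ z₀ + r → SolvesAt s U x z)
    (hb : ∀ x z, ‖x - x₀‖ ≤ r → z₀ - r ≤ z → z ≤ z₀ + r → |U x z| ≤ M)
    {t : ℝ} (ht : 0 ≤ t) (htr : t ≤ r) :
    U x₀ (z₀ + t) - U x₀ (z₀ - t) ≤ 8 * (n + 3) * M / r * t + 4 * M / r ^ 2 * t ^ 2 := by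
  have hn : (0 : ℝ) ≤ n := n.cast_nonneg
  set α : ℝ := 2 * M / r ^ 2 with hα
  have hα0 : 0 < α := by positivity
  have hαM : α * r ^ 2 = 2 * M := by rw [hα]; field_simp
  set γ : ℝ := (n + 3) * α with hγ
  have hγ0 : 0 < γ := by positivity
  set β : ℝ := 2 * r * γ with hβ
  set W : EuclideanSpace ℝ (Fin n) × ℝ × ℝ → ℝ := fun p =>
    (U p.1 p.2.1 - U p.1 p.2.2)
      - (α * (‖p.1 - x₀‖ ^ 2 + (p.2.1 - z₀) ^ 2 + (p.2.2 - z₀) ^ 2)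
        + (β * (p.2.1 - p.2.2) - γ * (p.2.1 - p.2.2) ^ 2)) with hW
  set D : Set (EuclideanSpace ℝ (Fin n) × ℝ × ℝ) :=
    (Metric.closedBall x₀ r ×ˢ Icc (z₀ - r) (z₀ + r) ×ˢ Icc (z₀ - r) (z₀ + r))
      ∩ {p | p.2.2 ≤ p.2.1} with hD
  have hDc : IsCompact D :=
    ((isCompact_closedBall x₀ r).prod (isCompact_Icc.prod isCompact_Icc)).inter_right
      (isClosed_le (by fun_prop) (by fun_prop))
  have hWc : ContinuousOn W D := by
    refine ContinuousOn.sub (ContinuousOn.sub ?_ ?_) (Continuous.continuousOn (by fun_prop))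
    · exact hc.comp (f := fun p : EuclideanSpace ℝ (Fin n) × ℝ × ℝ => (p.1, p.2.1))
        (Continuous.continuousOn (by fun_prop)) fun p hp => ⟨hp.1.1, hp.1.2.1⟩
    · exact hc.comp (f := fun p : EuclideanSpace ℝ (Fin n) × ℝ × ℝ => (p.1, p.2.2))
        (Continuous.continuousOn (by fun_prop)) fun p hp => ⟨hp.1.1, hp.1.2.2⟩
  have hmem : (x₀, z₀ + t, z₀ - t) ∈ D :=
    ⟨⟨Metric.mem_closedBall_self hr.le, ⟨by linarith, by linarith⟩, by linarith, by linarith⟩,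
      by show z₀ - t ≤ z₀ + t; linarith⟩
  obtain ⟨⟨x, z, w⟩, ⟨⟨hx, hz, hw⟩, hwz⟩, hmax⟩ := hDc.exists_isMaxOn ⟨_, hmem⟩ hWc
  simp only [Metric.mem_closedBall, dist_eq_norm] at hx
  simp only [mem_Icc] at hz hw
  replace hwz : w ≤ z := hwz
  have hle : W (x, z, w) ≤ 0 := by
    by_contra! hcon
    simp only [hW] at hcon
    have hp' := abs_le.1 (hb _ z hx hz.1 hz.2)
    have hq' := abs_le.1 (hb _ w hx hw.1 hw.2)
    have hβγ : 0 ≤ β * (z - w) - γ * (z - w) ^ 2 := by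
      have : β * (z - w) - γ * (z - w) ^ 2 = γ * (z - w) * (2 * r - (z - w)) := by rw [hβ]; ring
      rw [this]
      exact mul_nonneg (mul_nonneg hγ0.le (by linarith)) (by linarith [hz.2, hw.1])
    have hwz' : w < z := by
      refine hwz.lt_of_ne fun h' => ?_
      subst h'
      have : 0 ≤ α * (‖x - x₀‖ ^ 2 + (w - z₀) ^ 2 + (w - z₀) ^ 2) := by positivity
      simp at hcon
      linarith
    have hlat : ‖x - x₀‖ ^ 2 + (z - z₀) ^ 2 + (w - z₀) ^ 2 < r ^ 2 := by
      by_contra! h'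
      have := mul_le_mul_of_nonneg_left h' hα0.le
      linarith
    have hx' : ‖x - x₀‖ < r :=
      lt_of_pow_lt_pow_left₀ 2 hr.le (by nlinarith [sq_nonneg (z - z₀), sq_nonneg (w - z₀)])
    have hz' : |z - z₀| < r :=
      abs_lt_of_sq_lt_sq (by nlinarith [sq_nonneg ‖x - x₀‖, sq_nonneg (w - z₀)]) hr.le
    have hw' : |w - z₀| < r :=
      abs_lt_of_sq_lt_sq (by nlinarith [sq_nonneg ‖x - x₀‖, sq_nonneg (z - z₀)]) hr.le
    have hloc : IsLocalMax W (x, z, w) := hmax.isLocalMax <| Filter.inter_mem (prod_mem_nhds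
      (Metric.closedBall_mem_nhds_of_mem (by simpa [dist_eq_norm] using hx'))
      (prod_mem_nhds (Icc_mem_nhds (by linarith [(abs_lt.1 hz').1])
        (by linarith [(abs_lt.1 hz').2])) (Icc_mem_nhds (by linarith [(abs_lt.1 hw').1])
        (by linarith [(abs_lt.1 hw').2]))))
      (Filter.mem_of_superset ((isOpen_lt (f := fun p : EuclideanSpace ℝ (Fin n) × ℝ × ℝ => p.2.2)
        (g := fun p => p.2.1) (by fun_prop) (by fun_prop)).mem_nhds hwz')
        fun p (hp : p.2.2 < p.2.1) => hp.le)
    obtain ⟨a₁, b₁, c₁, d₁, ha₁, hcd₁, heq₁⟩ := hU _ z hx hz.1 hz.2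
    obtain ⟨a₂, b₂, c₂, d₂, ha₂, hcd₂, heq₂⟩ := hU _ w hx hw.1 hw.2
    have htan : ∀ j, b₁ j - b₂ j ≤ α * 2 := by
      intro j
      have hbar := (((((HasSecondDeriv.norm_sq_line (x - x₀) j).add
        (HasSecondDeriv.const ((z - z₀) ^ 2) 0)).add
        (HasSecondDeriv.const ((w - z₀) ^ 2) 0)).const_mul α).add
          (HasSecondDeriv.const (β * (z - w) - γ * (z - w) ^ 2) 0))
      have := (((ha₁ j).sub (ha₂ j)).eq_and_le_of_isLocalMax hbar ?_).2
      · simpa using this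
      · have := IsLocalMax.comp_continuous (f := W)
          (g := fun t : ℝ => (x + t • EuclideanSpace.single j (1 : ℝ), z, w)) (b := 0)
          (by simpa using hloc) (by fun_prop)
        simpa only [hW, Function.comp_def, add_sub_right_comm] using this
    have hnor₁ : c₁ = 2 * (α * (z - z₀)) + (β - 2 * γ * (z - w)) ∧ d₁ ≤ 2 * α - 2 * γ := by
      have hbar := HasSecondDeriv.quadratic
        (U x w + (α * (‖x - x₀‖ ^ 2 + (z - z₀) ^ 2 + (w - z₀) ^ 2)
          + (β * (z - w) - γ * (z - w) ^ 2)))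
        (2 * (α * (z - z₀)) + (β - 2 * γ * (z - w))) (2 * α - 2 * γ)
      refine hcd₁.comp_const_add.eq_and_le_of_isLocalMax hbar ?_
      have := IsLocalMax.comp_continuous (f := W)
        (g := fun t : ℝ => (x, z + t, w)) (b := 0) (by simpa using hloc) (by fun_prop)
      convert this using 2 with y
      simp only [hW, Function.comp_def]
      ring
    have hnor₂ : -c₂ = 2 * (α * (w - z₀)) - (β - 2 * γ * (z - w)) ∧ -d₂ ≤ 2 * α - 2 * γ := by
      have hbar := HasSecondDeriv.quadratic
        (-U x z + (α * (‖x - x₀‖ ^ 2 + (z - z₀) ^ 2 + (w - z₀) ^ 2)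
          + (β * (z - w) - γ * (z - w) ^ 2)))
        (2 * (α * (w - z₀)) - (β - 2 * γ * (z - w))) (2 * α - 2 * γ)
      refine hcd₂.comp_const_add.neg.eq_and_le_of_isLocalMax hbar ?_
      have := IsLocalMax.comp_continuous (f := W)
        (g := fun t : ℝ => (x, z, w + t)) (b := 0) (by simpa using hloc) (by fun_prop)
      convert this using 2 with y
      simp only [hW, Function.comp_def]
      ring
    have hsum : ∑ j, (b₁ j - b₂ j) ≤ ∑ j : Fin n, α * 2 := Finset.sum_le_sum fun j _ => htan j
    rw [Finset.sum_sub_distrib] at hsum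
    simp only [Finset.sum_const, Finset.card_univ, Fintype.card_fin, nsmul_eq_mul] at hsum
    have hdr₁ := mul_le_mul_of_nonneg_left
      (drift_mul_le hs hr (by linarith : 39 * r ≤ z) hz'.le) hα0.le
    have hdr₂ := mul_le_mul_of_nonneg_left
      (drift_mul_le hs hr (by linarith : 39 * r ≤ w) hw'.le) hα0.le
    have hdr₃ : ((1 - s) / z - (1 - s) / w) * (β - 2 * γ * (z - w)) ≤ 2 * (2 * γ) / 1521 := by
      refine drift_sub_mul_le hs hr (by linarith) (by linarith)
        (abs_le.2 ⟨by linarith, by linarith⟩) ?_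
      have : β - 2 * γ * (z - w) = 2 * γ * (r - (z - w)) := by rw [hβ]; ring
      rw [this, abs_mul, abs_of_pos (by positivity : 0 < 2 * γ)]
      exact mul_le_mul_of_nonneg_left (abs_le.2 ⟨by linarith, by linarith⟩) (by positivity)
    have hdr₄ : (1 - s) / z * c₁ + (1 - s) / w * (-c₂) =
        2 * (α * ((1 - s) / z * (z - z₀))) + 2 * (α * ((1 - s) / w * (w - z₀)))
          + ((1 - s) / z - (1 - s) / w) * (β - 2 * γ * (z - w)) := by
      rw [hnor₁.1, hnor₂.1]; ring
    have e1 : γ = n * α + 3 * α := by rw [hγ]; ring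
    have e2 : 0 ≤ n * α := by positivity
    linarith [hnor₁.2, hnor₂.2]
  have hfin := (hmax hmem : W (x₀, z₀ + t, z₀ - t) ≤ W (x, z, w)).trans hle
  simp only [hW, sub_self, norm_zero] at hfin
  have h1 : 0 ≤ γ * t ^ 2 := by positivity
  have h2 : 8 * (n + 3) * M / r = 2 * β := by rw [hβ, hγ, hα]; field_simp; ring
  have h3 : 4 * M / r ^ 2 = 2 * α := by rw [hα]; ring
  rw [h2, h3]
  linarith

/-- Interior gradient estimate on a ball whose radius is small compared with the distance to the
boundary. -/
theorem abs_partialDeriv_le {n : ℕ} {s r z₀ M : ℝ} (hs : s ∈ Ioo (0 : ℝ) 2)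
    {U : EuclideanSpace ℝ (Fin n) → ℝ → ℝ} {x₀ : EuclideanSpace ℝ (Fin n)}
    (hr : 0 < r) (hz₀ : z₀ = 40 * r) (hM : 0 < M)
    (hc : ContinuousOn (fun p : EuclideanSpace ℝ (Fin n) × ℝ => U p.1 p.2)
      (Metric.closedBall x₀ (2 * r) ×ˢ Icc (z₀ - r) (z₀ + r)))
    (hU : ∀ x z, ‖x - x₀‖ ≤ 2 * r → z₀ - r ≤ z → z ≤ z₀ + r → SolvesAt s U x z)
    (hb : ∀ x z, ‖x - x₀‖ ≤ 2 * r → z₀ - r ≤ z → z ≤ z₀ + r → |U x z| ≤ M) :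
    (∀ i, |deriv (fun t : ℝ => U (x₀ + t • EuclideanSpace.single i (1 : ℝ)) z₀) 0|
      ≤ 4 * (n + 3) * M / r) ∧
    |deriv (fun z => U x₀ z) z₀| ≤ 4 * (n + 3) * M / r := by
  have key : ∀ V : EuclideanSpace ℝ (Fin n) → ℝ → ℝ,
      ContinuousOn (fun p : EuclideanSpace ℝ (Fin n) × ℝ => V p.1 p.2)
        (Metric.closedBall x₀ (2 * r) ×ˢ Icc (z₀ - r) (z₀ + r)) →
      (∀ x z, ‖x - x₀‖ ≤ 2 * r → z₀ - r ≤ z → z ≤ z₀ + r → SolvesAt s V x z) →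
      (∀ x z, ‖x - x₀‖ ≤ 2 * r → z₀ - r ≤ z → z ≤ z₀ + r → |V x z| ≤ M) →
      (∀ i, deriv (fun t : ℝ => V (x₀ + t • EuclideanSpace.single i (1 : ℝ)) z₀) 0
        ≤ 4 * (n + 3) * M / r) ∧
      deriv (fun z => V x₀ z) z₀ ≤ 4 * (n + 3) * M / r := by
    intro V hc hV hb
    obtain ⟨a, b, c, d, ha, hcd, -⟩ := hV x₀ z₀ (by simpa using hr.le) (by linarith) (by linarith)
    have hMr : 0 < M / r := by positivity
    have hnMr : 0 ≤ n * (M / r) := by positivity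
    refine ⟨fun i => ?_, ?_⟩
    · rw [(ha i).hasDerivAt.deriv]
      have := two_mul_le_of_symm_diff_le (k := 2 * (n + 2) * M / r) (l := 0) hr
        (ha i).hasDerivAt fun y hy hyr => by
          simpa [sub_eq_add_neg] using
            tangential_difference_le hs hr hz₀ hM hc hV hb i hy hyr
      rw [mul_div_assoc] at this ⊢
      linarith
    · rw [hcd.hasDerivAt.deriv]
      have := two_mul_le_of_symm_diff_le hr hcd.hasDerivAt fun y hy hyr =>
        normal_difference_le hs hr hz₀ hM
          (hc.mono (prod_mono (Metric.closedBall_subset_closedBall (by linarith)) subset_rfl))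
          (fun x z hx => hV x z (by linarith)) (fun x z hx => hb x z (by linarith)) hy hyr
      rw [mul_div_assoc] at this ⊢
      linarith
  obtain ⟨h1, h2⟩ := key U hc hU hb
  obtain ⟨h3, h4⟩ := key (fun x z => -U x z) hc.neg (fun x z hx hz hz' => (hU x z hx hz hz').neg)
    (fun x z hx hz hz' => by simpa using hb x z hx hz hz')
  simp only [deriv.fun_neg] at h3 h4
  exact ⟨fun i => abs_le.2 ⟨by linarith [h3 i], h1 i⟩, abs_le.2 ⟨by linarith, h2⟩⟩

theorem solvesAt_of_contDiffAt {n : ℕ} {s : ℝ} {U : EuclideanSpace ℝ (Fin n) → ℝ → ℝ}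
    {x : EuclideanSpace ℝ (Fin n)} {z : ℝ}
    (hU : ContDiffAt ℝ 2 (fun q : EuclideanSpace ℝ (Fin n) × ℝ => U q.1 q.2) (x, z))
    (heq : (∑ i : Fin n,
        deriv (deriv (fun r : ℝ => U (x + r • EuclideanSpace.single i (1 : ℝ)) z)) 0) +
      deriv (deriv (fun w : ℝ => U x w)) z + ((1 - s) / z) * deriv (fun w : ℝ => U x w) z = 0) :
    SolvesAt s U x z := by
  refine ⟨_, _, _, _, fun j => HasSecondDeriv.of_contDiffAt ?_,
    HasSecondDeriv.of_contDiffAt ?_, heq⟩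
  · exact ContDiffAt.comp (g := fun q : EuclideanSpace ℝ (Fin n) × ℝ => U q.1 q.2)
      (f := fun t : ℝ => (x + t • EuclideanSpace.single j (1 : ℝ), z)) 0
      (by simpa using hU) (by fun_prop)
  · exact ContDiffAt.comp (g := fun q : EuclideanSpace ℝ (Fin n) × ℝ => U q.1 q.2)
      (f := fun w : ℝ => (x, w)) z hU (by fun_prop)

theorem sqrt_sum_sq_add_sq_le {n : ℕ} {a : Fin n → ℝ} {c G : ℝ} (ha : ∀ i, |a i| ≤ G)
    (hc : |c| ≤ G) : Real.sqrt ((∑ i, a i ^ 2) + c ^ 2) ≤ (n + 1) * G := by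
  have hG : 0 ≤ G := (abs_nonneg _).trans hc
  have hn : (0 : ℝ) ≤ n := n.cast_nonneg
  refine Real.sqrt_le_iff.2 ⟨by positivity, ?_⟩
  have h1 : ∑ i, a i ^ 2 ≤ ∑ _i : Fin n, G ^ 2 := Finset.sum_le_sum fun i _ =>
    sq_le_sq' (abs_le.1 (ha i)).1 (abs_le.1 (ha i)).2
  have h2 := sq_le_sq' (abs_le.1 hc).1 (abs_le.1 hc).2
  simp only [Finset.sum_const, Finset.card_univ, Fintype.card_fin, nsmul_eq_mul] at h1
  have h3 : 0 ≤ n * G ^ 2 := by positivity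
  have h4 : 0 ≤ (n * G) ^ 2 := by positivity
  nlinarith

/-- The global form of the boundary decay on `‖x‖ ≤ 21/20`. -/
theorem abs_le_mul_rpow {n : ℕ} {s M : ℝ} (hs : s ∈ Ioo (0 : ℝ) 2)
    {U : EuclideanSpace ℝ (Fin n) → ℝ → ℝ}
    (hc : ContinuousOn (fun q : EuclideanSpace ℝ (Fin n) × ℝ => U q.1 q.2)
      {q : EuclideanSpace ℝ (Fin n) × ℝ | ‖q.1‖ ^ 2 + q.2 ^ 2 ≤ 4 ∧ 0 ≤ q.2})
    (hU : ∀ x z, ‖x‖ ^ 2 + z ^ 2 < 4 → 0 < z → SolvesAt s U x z)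
    (h0 : ∀ x : EuclideanSpace ℝ (Fin n), ‖x‖ < 3 / 2 → U x 0 = 0) (hM : 0 < M)
    (hb : ∀ x z, ‖x‖ ^ 2 + z ^ 2 < (6 / 5) ^ 2 → 0 < z → |U x z| ≤ M)
    {x : EuclideanSpace ℝ (Fin n)} {z : ℝ} (hx : ‖x‖ ≤ 21 / 20) (hz : 0 < z)
    (hxz : ‖x‖ ^ 2 + z ^ 2 < (6 / 5) ^ 2) :
    |U x z| ≤ 640000 * (n + 2) ^ 2 * M * z ^ s := by
  have hn : (0 : ℝ) ≤ n := n.cast_nonneg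
  rcases le_or_gt z (1 / 10) with hz1 | hz1
  · have hnorm : ∀ y, ‖y - x‖ ≤ 1 / 10 → ‖y‖ ≤ 23 / 20 := fun y hy => by
      linarith [norm_le_norm_add_norm_sub' y x]
    have hball : ∀ y w, ‖y - x‖ ≤ 1 / 10 → 0 ≤ w → w ≤ 1 / 10 → ‖y‖ ^ 2 + w ^ 2 < (6 / 5) ^ 2 :=
      fun y w hy hw hw' => by nlinarith [hnorm y hy, norm_nonneg y]
    have hc' : ContinuousOn (fun q : EuclideanSpace ℝ (Fin n) × ℝ => U q.1 q.2)
        (Metric.closedBall x (1 / 10) ×ˢ Icc 0 (1 / 10)) := by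
      refine hc.mono ?_
      rintro ⟨y, w⟩ ⟨hy, hw⟩
      exact ⟨by linarith [hball y w (by simpa [dist_eq_norm] using hy) hw.1 hw.2], hw.1⟩
    have hU' : ∀ y w, ‖y - x‖ < 1 / 10 → 0 < w → w < 1 / 10 → SolvesAt s U y w :=
      fun y w hy hw hw' => hU y w (by linarith [hball y w hy.le hw.le hw'.le]) hw
    have h0' : ∀ y, ‖y - x‖ ≤ 1 / 10 → U y 0 = 0 := fun y hy => h0 y (by linarith [hnorm y hy])
    have hb' : ∀ y w, ‖y - x‖ ≤ 1 / 10 → 0 < w → w ≤ 1 / 10 → |U y w| ≤ M :=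
      fun y w hy hw hw' => hb y w (hball y w hy hw.le hw') hw
    have e1 := le_mul_rpow_of_trace_eq_zero hs (by norm_num) (by norm_num) hM hc' hU' h0'
      (fun y w hy hw hw' => (abs_le.1 (hb' y w hy hw hw')).2) hz hz1
    have e2 := le_mul_rpow_of_trace_eq_zero (U := fun x z => -U x z) hs (by norm_num)
      (by norm_num) hM hc'.neg (fun y w hy hw hw' => (hU' y w hy hw hw').neg)
      (fun y hy => by simp [h0' y hy])
      (fun y w hy hw hw' => by linarith [(abs_le.1 (hb' y w hy hw hw')).1]) hz hz1
    have e3 : M / (1 / 10) ^ 4 * (64 * (n + 2) ^ 2) * z ^ s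
        = 640000 * (n + 2) ^ 2 * M * z ^ s := by ring
    rw [e3] at e1 e2
    exact abs_le.2 ⟨by linarith, e1⟩
  · have e1 : (1 / 10 : ℝ) ^ (2 : ℝ) ≤ z ^ s :=
      (Real.rpow_le_rpow_of_exponent_ge (by norm_num) (by norm_num) hs.2.le).trans
        (Real.rpow_le_rpow (by norm_num) hz1.le hs.1.le)
    norm_num at e1
    have e2 : (1 : ℝ) ≤ (n + 2) ^ 2 * (640000 * z ^ s) := by
      have : (1 : ℝ) * 1 ≤ (n + 2) ^ 2 * (640000 * z ^ s) :=
        mul_le_mul (by nlinarith) (by linarith) zero_le_one (by positivity)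
      linarith
    have := mul_le_mul_of_nonneg_left e2 hM.le
    linarith [hb x z hxz hz]

/-- Gradient estimate for the degenerate extension equation with vanishing trace
(Euclidean instance of Lemma 4.8): if `U` is a bounded continuous function on the closed
half-ball `B₂⁺`, smooth inside, solving `Δ_x U + ∂_{zz}U + ((1-s)/z)∂_z U = 0`, with zero
trace on `{|x| < 3/2}`, then `z^{1-s}|∇U| ≤ (C/s)·sup_{B_{6/5}⁺}|U|` in `B₁⁺`. -/
theorem gradient_estimate_vanishing_trace (n : ℕ) (hn : 1 ≤ n) :
    ∃ C : ℝ, 0 < C ∧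
      ∀ s : ℝ, s ∈ Ioo (0:ℝ) 2 →
      ∀ U : EuclideanSpace ℝ (Fin n) → ℝ → ℝ,
        ContinuousOn (fun q : EuclideanSpace ℝ (Fin n) × ℝ => U q.1 q.2)
          {q : EuclideanSpace ℝ (Fin n) × ℝ | ‖q.1‖ ^ 2 + q.2 ^ 2 ≤ 4 ∧ 0 ≤ q.2} →
        ContDiffOn ℝ (⊤ : ℕ∞) (fun q : EuclideanSpace ℝ (Fin n) × ℝ => U q.1 q.2)
          {q : EuclideanSpace ℝ (Fin n) × ℝ | ‖q.1‖ ^ 2 + q.2 ^ 2 < 4 ∧ 0 < q.2} →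
        (∀ (x : EuclideanSpace ℝ (Fin n)) (z : ℝ), ‖x‖ ^ 2 + z ^ 2 < 4 → 0 < z →
          (∑ i : Fin n,
              deriv (deriv (fun r : ℝ => U (x + r • EuclideanSpace.single i (1:ℝ)) z)) 0) +
            deriv (deriv (fun w : ℝ => U x w)) z +
            ((1 - s) / z) * deriv (fun w : ℝ => U x w) z = 0) →
        (∀ x : EuclideanSpace ℝ (Fin n), ‖x‖ < 3 / 2 → U x 0 = 0) →
        ∀ M : ℝ,
          (∀ (x : EuclideanSpace ℝ (Fin n)) (z : ℝ),
            ‖x‖ ^ 2 + z ^ 2 < (6 / 5) ^ 2 → 0 < z → |U x z| ≤ M) →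
        ∀ (x : EuclideanSpace ℝ (Fin n)) (z : ℝ), ‖x‖ ^ 2 + z ^ 2 < 1 → 0 < z →
          z ^ (1 - s) *
              Real.sqrt
                ((∑ i : Fin n,
                    (deriv (fun r : ℝ => U (x + r • EuclideanSpace.single i (1:ℝ)) z) 0) ^ 2) +
                  (deriv (fun w : ℝ => U x w) z) ^ 2) ≤
            C / s * M := by
  obtain ⟨N, hN⟩ : ∃ N : ℝ, N = 640000 * (n + 2) ^ 2 := ⟨_, rfl⟩
  have hN0 : 0 < N := by rw [hN]; positivity
  have hn0 : (0 : ℝ) ≤ n := n.cast_nonneg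
  obtain ⟨C, hC⟩ : ∃ C : ℝ, C = 2 * ((n + 1) * (640 * (n + 3) * N)) := ⟨_, rfl⟩
  have hC0 : 0 < C := by rw [hC]; positivity
  refine ⟨C, hC0, ?_⟩
  intro s hs U hc hd heq h0 M₀ hb₀ x z hxz hz
  have hs0 : 0 < s := hs.1
  have hopen : IsOpen {q : EuclideanSpace ℝ (Fin n) × ℝ | ‖q.1‖ ^ 2 + q.2 ^ 2 < 4 ∧ 0 < q.2} :=
    IsOpen.and (isOpen_lt (by fun_prop) (by fun_prop)) (isOpen_lt (by fun_prop) (by fun_prop))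
  have hU : ∀ x z, ‖x‖ ^ 2 + z ^ 2 < 4 → 0 < z → SolvesAt s U x z := by
    intro x z hx hz
    have h2 : (2 : WithTop ℕ∞) ≤ ((⊤ : ℕ∞) : WithTop ℕ∞) :=
      WithTop.coe_le_coe.2 (le_top : (2 : ℕ∞) ≤ ⊤)
    exact solvesAt_of_contDiffAt ((hd.of_le h2).contDiffAt (hopen.mem_nhds ⟨hx, hz⟩))
      (heq x z hx hz)
  have hM₀ : 0 ≤ M₀ := (abs_nonneg _).trans (hb₀ x z (by linarith) hz)
  have hmain : ∀ M, M₀ < M → z ^ (1 - s) *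
      Real.sqrt ((∑ i : Fin n,
        (deriv (fun r : ℝ => U (x + r • EuclideanSpace.single i (1 : ℝ)) z) 0) ^ 2) +
          (deriv (fun w : ℝ => U x w) z) ^ 2) ≤ C / s * M := by
    intro M hM₀M
    have hM : 0 < M := hM₀.trans_lt hM₀M
    have hb : ∀ x z, ‖x‖ ^ 2 + z ^ 2 < (6 / 5) ^ 2 → 0 < z → |U x z| ≤ M :=
      fun x z hx hz => (hb₀ x z hx hz).trans hM₀M.le
    have hx1 : ‖x‖ < 1 := by nlinarith [norm_nonneg x]
    have hz1 : z < 1 := by nlinarith [sq_nonneg ‖x‖]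
    set r := z / 40 with hr
    have hr0 : 0 < r := by positivity
    have hzr : z = 40 * r := by rw [hr]; ring
    have hnorm : ∀ y, ‖y - x‖ ≤ 2 * r → ‖y‖ ≤ ‖x‖ + 2 * r := fun y hy => by
      linarith [norm_le_norm_add_norm_sub' y x]
    have hball : ∀ y w, ‖y - x‖ ≤ 2 * r → z - r ≤ w → w ≤ z + r →
        ‖y‖ ^ 2 + w ^ 2 < (6 / 5) ^ 2 := by
      intro y w hy hw hw'
      have e1 : ‖y‖ ^ 2 ≤ (‖x‖ + 2 * r) ^ 2 := pow_le_pow_left₀ (norm_nonneg y) (hnorm y hy) 2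
      have e2 : w ^ 2 ≤ (z + r) ^ 2 := pow_le_pow_left₀ (by linarith) hw' 2
      have e3 : ‖x‖ * r ≤ 1 * r := mul_le_mul_of_nonneg_right hx1.le hr0.le
      have e4 : z * r ≤ 1 * r := mul_le_mul_of_nonneg_right hz1.le hr0.le
      nlinarith
    have hdecay : ∀ y w, ‖y‖ ≤ 21 / 20 → 0 < w → ‖y‖ ^ 2 + w ^ 2 < (6 / 5) ^ 2 →
        |U y w| ≤ N * M * w ^ s := fun y w hy hw hyw =>
      hN ▸ abs_le_mul_rpow hs hc hU h0 hM hb hy hw hyw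
    have hest := abs_partialDeriv_le hs (U := U) (x₀ := x) (M := N * M * (4 * z ^ s)) hr0 hzr
      (by positivity)
      (hc.mono (by
        rintro ⟨y, w⟩ ⟨hy, hw⟩
        exact ⟨by linarith [hball y w (by simpa [dist_eq_norm] using hy) hw.1 hw.2],
          by linarith [hw.1]⟩))
      (fun y w hy hw hw' => hU y w (by linarith [hball y w hy hw hw']) (by linarith))
      (fun y w hy hw hw' => by
        have hw0 : 0 < w := by linarith
        refine (hdecay y w (by linarith [hnorm y hy]) hw0 (hball y w hy hw hw')).trans ?_
        refine mul_le_mul_of_nonneg_left ?_ (by positivity)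
        calc w ^ s ≤ (2 * z) ^ s := Real.rpow_le_rpow hw0.le (by linarith) hs0.le
          _ = 2 ^ s * z ^ s := Real.mul_rpow (by norm_num) hz.le
          _ ≤ 2 ^ (2 : ℝ) * z ^ s := by
            refine mul_le_mul_of_nonneg_right ?_ (by positivity)
            exact Real.rpow_le_rpow_of_exponent_le (by norm_num) hs.2.le
          _ = 4 * z ^ s := by norm_num)
    have hsqrt := sqrt_sum_sq_add_sq_le hest.1 hest.2
    refine (mul_le_mul_of_nonneg_left hsqrt (by positivity)).trans ?_
    have hzz : z ^ (1 - s) * z ^ s = z := by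
      rw [← Real.rpow_add hz]; simp
    have e1 : z ^ (1 - s) * ((n + 1) * (4 * (n + 3) * (N * M * (4 * z ^ s)) / r))
        = C / 2 * M * ((z ^ (1 - s) * z ^ s) / z) := by
      rw [hr, hC]; field_simp; ring
    rw [e1, hzz, div_self hz.ne', mul_one]
    refine mul_le_mul_of_nonneg_right ?_ hM.le
    exact div_le_div_of_nonneg_left hC0.le hs0 hs.2.le
  rw [← div_le_iff₀' (by positivity)]
  exact le_of_forall_gt_imp_ge_of_dense fun M hM => by
    rw [div_le_iff₀' (by positivity)]
    exact hmain M hM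
end

section
/- Let n ≥ 1 be an integer. There exists a constant C > 0 depending only on n such that for every s ∈ (0,1) and every continuously differentiable function u : ℝⁿ → ℝ with |u| ≤ 1 on the unit ball B₁ := {x ∈ ℝⁿ : |x| < 1}, one has ∬_{B₁×B₁} |u(x) − u(y)|² / |x−y|^{n+s} dx dy ≤ (C/((1−s)s)) · (∫_{B₁} |∇u(x)| dx)^s · (∫_{B₁} |u(x)| dx)^{1−s}. -/
open MeasureTheory Real Set

/-- The fundamental theorem of calculus along a segment, as an upper bound on increments. -/
theorem enorm_sub_le_lintegral_fderiv {E : Type*} [NormedAddCommGroup E] [NormedSpace ℝ E]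
    {u : E → ℝ} (hu : ContDiff ℝ 1 u) (x h : E) :
    ‖u (x + h) - u x‖ₑ ≤ ∫⁻ t in Ioc (0 : ℝ) 1, ‖fderiv ℝ u (x + t • h)‖ₑ * ‖h‖ₑ := by
  have hd : ∀ t : ℝ, HasDerivAt (fun t : ℝ => u (x + t • h)) (fderiv ℝ u (x + t • h) h) t := by
    intro t
    have h1 : HasDerivAt (fun t : ℝ => x + t • h) h t := by
      simpa using ((hasDerivAt_id t).smul_const h).const_add x
    exact ((hu.differentiable one_ne_zero) _).hasFDerivAt.comp_hasDerivAt t h1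
  have hc : Continuous fun t : ℝ => fderiv ℝ u (x + t • h) h := by
    have := hu.continuous_fderiv one_ne_zero
    fun_prop
  have hftc := intervalIntegral.integral_eq_sub_of_hasDerivAt (a := 0) (b := 1)
    (fun t _ => hd t) (hc.intervalIntegrable _ _)
  rw [intervalIntegral.integral_of_le zero_le_one] at hftc
  simp only [one_smul, zero_smul, add_zero] at hftc
  rw [← hftc]
  exact (enorm_integral_le_lintegral_enorm _).trans
    (lintegral_mono fun t => ContinuousLinearMap.le_opENorm _ _)

section Translation

variable {E : Type*} [NormedAddCommGroup E] [MeasurableSpace E] [BorelSpace E]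
  (μ : Measure E) [μ.IsAddHaarMeasure] {s : Set E} {u : E → ℝ}

/-- The `L¹` norm of an increment is at most twice the `L¹` norm of the function. -/
theorem setLIntegral_enorm_sub_le_two_mul (hs : MeasurableSet s) (hu : Measurable u) (h : E) :
    ∫⁻ x in s ∩ (fun x => x + h) ⁻¹' s, ‖u (x + h) - u x‖ₑ ∂μ ≤ 2 * ∫⁻ x in s, ‖u x‖ₑ ∂μ := by
  have hm : Measurable fun x : E => x + h := measurable_add_const h
  calc ∫⁻ x in s ∩ (fun x => x + h) ⁻¹' s, ‖u (x + h) - u x‖ₑ ∂μ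
      ≤ ∫⁻ x in s ∩ (fun x => x + h) ⁻¹' s, (‖u (x + h)‖ₑ + ‖u x‖ₑ) ∂μ :=
        lintegral_mono fun x => enorm_sub_le
    _ = ∫⁻ x in s ∩ (fun x => x + h) ⁻¹' s, ‖u (x + h)‖ₑ ∂μ
        + ∫⁻ x in s ∩ (fun x => x + h) ⁻¹' s, ‖u x‖ₑ ∂μ :=
        lintegral_add_left (hu.comp hm).enorm _
    _ ≤ ∫⁻ x in (fun x => x + h) ⁻¹' s, ‖u (x + h)‖ₑ ∂μ + ∫⁻ x in s, ‖u x‖ₑ ∂μ :=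
        add_le_add (lintegral_mono_set inter_subset_right) (lintegral_mono_set inter_subset_left)
    _ = 2 * ∫⁻ x in s, ‖u x‖ₑ ∂μ := by
        rw [(measurePreserving_add_right μ h).setLIntegral_comp_preimage hs hu.enorm, two_mul]

/-- On a convex set, the `L¹` norm of the increment by `h` is at most `‖h‖` times the `L¹` norm
of the derivative. -/
theorem Convex.setLIntegral_enorm_sub_le_fderiv [NormedSpace ℝ E] [FiniteDimensional ℝ E]
    (hsc : Convex ℝ s) (hs : MeasurableSet s) (hu : ContDiff ℝ 1 u) (h : E) :
    ∫⁻ x in s ∩ (fun x => x + h) ⁻¹' s, ‖u (x + h) - u x‖ₑ ∂μ ≤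
      ‖h‖ₑ * ∫⁻ x in s, ‖fderiv ℝ u x‖ₑ ∂μ := by
  have hc := hu.continuous_fderiv one_ne_zero
  have hcm : Measurable fun x => ‖fderiv ℝ u x‖ₑ := hc.enorm.measurable
  have hjm : Measurable fun p : E × ℝ => ‖fderiv ℝ u (p.1 + p.2 • h)‖ₑ * ‖h‖ₑ := by
    have : Continuous fun p : E × ℝ => fderiv ℝ u (p.1 + p.2 • h) := by fun_prop
    exact this.enorm.measurable.mul_const _
  calc ∫⁻ x in s ∩ (fun x => x + h) ⁻¹' s, ‖u (x + h) - u x‖ₑ ∂μ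
      ≤ ∫⁻ x in s ∩ (fun x => x + h) ⁻¹' s,
          (∫⁻ t in Ioc (0 : ℝ) 1, ‖fderiv ℝ u (x + t • h)‖ₑ * ‖h‖ₑ) ∂μ :=
        lintegral_mono fun x => enorm_sub_le_lintegral_fderiv hu x h
    _ = ∫⁻ t in Ioc (0 : ℝ) 1, ∫⁻ x in s ∩ (fun x => x + h) ⁻¹' s,
          ‖fderiv ℝ u (x + t • h)‖ₑ * ‖h‖ₑ ∂μ :=
        lintegral_lintegral_swap hjm.aemeasurable
    _ ≤ ∫⁻ t in Ioc (0 : ℝ) 1, ‖h‖ₑ * ∫⁻ x in s, ‖fderiv ℝ u x‖ₑ ∂μ := by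
        refine setLIntegral_mono measurable_const fun t ht => ?_
        have hsub : s ∩ (fun x => x + h) ⁻¹' s ⊆ (fun x => x + t • h) ⁻¹' s := fun x hx =>
          hsc.add_smul_mem hx.1 hx.2 ⟨ht.1.le, ht.2⟩
        rw [lintegral_mul_const' _ _ enorm_ne_top, mul_comm]
        gcongr ‖h‖ₑ * ?_
        refine (lintegral_mono_set hsub).trans_eq ?_
        exact (measurePreserving_add_right μ (t • h)).setLIntegral_comp_preimage hs hcm
    _ = ‖h‖ₑ * ∫⁻ x in s, ‖fderiv ℝ u x‖ₑ ∂μ := by simp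

end Translation

section Radial

variable {a b s : ℝ}

theorem integrableOn_min_mul_rpow (ha : 0 < a) (hb : 0 < b) (hs : s ∈ Ioo (0 : ℝ) 1) :
    IntegrableOn (fun r : ℝ => min (r * a) b * r ^ (-1 - s)) (Ioi 0) ∧
      ∫ r in Ioi (0 : ℝ), min (r * a) b * r ^ (-1 - s) =
        a ^ s * b ^ (1 - s) / ((1 - s) * s) := by
  obtain ⟨hs0, hs1⟩ := hs
  have hδ : 0 < b / a := div_pos hb ha
  have e1 : EqOn (fun r : ℝ => a * r ^ (-s)) (fun r => min (r * a) b * r ^ (-1 - s))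
      (Ioc 0 (b / a)) := by
    intro r hr
    have : r * a ≤ b := (le_div_iff₀ ha).1 hr.2
    simp only [min_eq_left this]
    rw [show -s = 1 + (-1 - s) by ring, rpow_add hr.1, rpow_one]
    ring
  have e2 : EqOn (fun r : ℝ => b * r ^ (-1 - s)) (fun r => min (r * a) b * r ^ (-1 - s))
      (Ioi (b / a)) := by
    intro r hr
    have : b ≤ r * a := (div_le_iff₀ ha).1 (le_of_lt hr)
    simp only [min_eq_right this]
  have i1 : IntegrableOn (fun r : ℝ => a * r ^ (-s)) (Ioc 0 (b / a)) :=
    ((intervalIntegral.intervalIntegrable_rpow' (by linarith)).1).const_mul a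
  have i2 : IntegrableOn (fun r : ℝ => b * r ^ (-1 - s)) (Ioi (b / a)) :=
    (integrableOn_Ioi_rpow_of_lt (by linarith) hδ).const_mul b
  have j1 := i1.congr_fun e1 measurableSet_Ioc
  have j2 := i2.congr_fun e2 measurableSet_Ioi
  rw [← Ioc_union_Ioi_eq_Ioi hδ.le]
  refine ⟨j1.union j2, ?_⟩
  rw [setIntegral_union (Ioc_disjoint_Ioi le_rfl) measurableSet_Ioi j1 j2,
    ← setIntegral_congr_fun measurableSet_Ioc e1, ← setIntegral_congr_fun measurableSet_Ioi e2,
    integral_const_mul, integral_const_mul, integral_Ioi_rpow_of_lt (by linarith) hδ,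
    ← intervalIntegral.integral_of_le hδ.le, integral_rpow (Or.inl (by linarith)),
    zero_rpow (by linarith), show -s + 1 = 1 - s by ring, show -1 - s + 1 = -s by ring,
    div_rpow hb.le ha.le, div_rpow hb.le ha.le, rpow_neg hb.le, rpow_neg ha.le,
    rpow_sub hb, rpow_sub ha, rpow_one, rpow_one]
  have := rpow_pos_of_pos ha s
  have := rpow_pos_of_pos hb s
  have : 1 - s ≠ 0 := by linarith
  field_simp
  ring

theorem lintegral_min_mul_rpow_norm {E : Type*} [NormedAddCommGroup E] [NormedSpace ℝ E]
    [FiniteDimensional ℝ E] [Nontrivial E] [MeasurableSpace E] [BorelSpace E]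
    (μ : Measure E) [μ.IsAddHaarMeasure] (ha : 0 ≤ a) (hb : 0 ≤ b) (hs : s ∈ Ioo (0 : ℝ) 1) :
    ∫⁻ h : E, ENNReal.ofReal (min (‖h‖ * a) b * ‖h‖ ^ (-((Module.finrank ℝ E : ℝ) + s))) ∂μ =
      ENNReal.ofReal (Module.finrank ℝ E * μ.real (Metric.ball 0 1) *
        (a ^ s * b ^ (1 - s) / ((1 - s) * s))) := by
  rcases ha.eq_or_lt with rfl | ha
  · simp [min_eq_left hb, zero_rpow hs.1.ne']
  rcases hb.eq_or_lt with rfl | hb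
  · have h0 : ∀ h : E, min (‖h‖ * a) 0 = 0 := fun h => min_eq_right (by positivity)
    have : 1 - s ≠ 0 := by linarith [hs.2]
    simp [h0, zero_rpow this]
  set d := Module.finrank ℝ E
  have hd : 0 < d := Module.finrank_pos
  set f : ℝ → ℝ := fun r => min (r * a) b * r ^ (-((d : ℝ) + s)) with hf
  have hfe : EqOn (fun r : ℝ => min (r * a) b * r ^ (-1 - s)) (fun r => r ^ (d - 1) • f r)
      (Ioi 0) := by
    intro r hr
    have hr : 0 < r := hr
    simp only [hf, smul_eq_mul]
    rw [mul_left_comm, ← rpow_natCast, ← rpow_add hr, Nat.cast_pred hd]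
    congr 2
    ring
  obtain ⟨h1, h2⟩ := integrableOn_min_mul_rpow ha hb hs
  have h_integrable : Integrable (fun h : E => f ‖h‖) μ :=
    (integrable_fun_norm_addHaar μ).2 (h1.congr_fun hfe measurableSet_Ioi)
  have hval := integral_fun_norm_addHaar μ f
  rw [← setIntegral_congr_fun measurableSet_Ioi hfe, h2] at hval
  rw [← ofReal_integral_eq_lintegral_ofReal h_integrable (ae_of_all _ fun h => by positivity), hval,
    nsmul_eq_mul, smul_eq_mul, mul_assoc]

end Radial

theorem setLIntegral_prod_eq_lintegral_add {E : Type*} [AddGroup E] [MeasurableSpace E]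
    [MeasurableAdd₂ E] (μ : Measure E) [SFinite μ] [μ.IsAddLeftInvariant] {s : Set E}
    (hs : MeasurableSet s) {F : E × E → ENNReal} (hF : Measurable F) :
    ∫⁻ q in s ×ˢ s, F q ∂(μ.prod μ) =
      ∫⁻ h, ∫⁻ x in s ∩ (fun x => x + h) ⁻¹' s, F (x, x + h) ∂μ ∂μ := by
  have hG : Measurable ((s ×ˢ s).indicator F) := hF.indicator (hs.prod hs)
  rw [← lintegral_indicator (hs.prod hs), lintegral_prod _ hG.aemeasurable]
  calc ∫⁻ x, ∫⁻ y, (s ×ˢ s).indicator F (x, y) ∂μ ∂μ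
      = ∫⁻ x, ∫⁻ h, (s ×ˢ s).indicator F (x, x + h) ∂μ ∂μ :=
        lintegral_congr fun x =>
          (lintegral_add_left_eq_self (fun y => (s ×ˢ s).indicator F (x, y)) x).symm
    _ = ∫⁻ h, ∫⁻ x, (s ×ˢ s).indicator F (x, x + h) ∂μ ∂μ :=
        lintegral_lintegral_swap
          (hG.comp (measurable_fst.prodMk (measurable_fst.add measurable_snd))).aemeasurable
    _ = _ := by
        refine lintegral_congr fun h => ?_
        rw [← lintegral_indicator (hs.inter (measurable_add_const h hs))]
        rfl

theorem measurable_sq_abs_sub_div_rpow {E : Type*} [NormedAddCommGroup E]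
    [SecondCountableTopology E] [MeasurableSpace E] [BorelSpace E] {u : E → ℝ}
    (hu : Continuous u) (p : ℝ) :
    Measurable fun q : E × E => |u q.1 - u q.2| ^ 2 / ‖q.1 - q.2‖ ^ p := by
  have h1 : Continuous fun q : E × E => |u q.1 - u q.2| ^ 2 := by fun_prop
  have h2 : Continuous fun q : E × E => ‖q.1 - q.2‖ := by fun_prop
  exact h1.measurable.div (h2.measurable.pow_const _)

/-- The interpolation inequality on a convex set, with an explicit constant. -/
theorem setLIntegral_gagliardo_le {E : Type*} [NormedAddCommGroup E] [NormedSpace ℝ E]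
    [FiniteDimensional ℝ E] [Nontrivial E] [MeasurableSpace E] [BorelSpace E]
    (μ : Measure E) [μ.IsAddHaarMeasure] {B : Set E} (hBc : Convex ℝ B) (hB : MeasurableSet B)
    {u : E → ℝ} (hu : ContDiff ℝ 1 u) (hu1 : ∀ x ∈ B, |u x| ≤ 1)
    (huB : IntegrableOn u B μ) (hdB : IntegrableOn (fderiv ℝ u) B μ)
    {s : ℝ} (hs : s ∈ Ioo (0 : ℝ) 1) :
    ∫⁻ q in B ×ˢ B, ENNReal.ofReal
        (|u q.1 - u q.2| ^ 2 / ‖q.1 - q.2‖ ^ ((Module.finrank ℝ E : ℝ) + s)) ∂(μ.prod μ) ≤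
      ENNReal.ofReal (4 * (Module.finrank ℝ E * μ.real (Metric.ball 0 1)) / ((1 - s) * s) *
        (∫ x in B, ‖fderiv ℝ u x‖ ∂μ) ^ s * (∫ x in B, |u x| ∂μ) ^ (1 - s)) := by
  set d := Module.finrank ℝ E
  set a := ∫ x in B, ‖fderiv ℝ u x‖ ∂μ
  set b := ∫ x in B, |u x| ∂μ
  have ha : 0 ≤ a := integral_nonneg fun _ => norm_nonneg _
  have hb : 0 ≤ b := integral_nonneg fun _ => abs_nonneg _
  have hae : ∫⁻ x in B, ‖fderiv ℝ u x‖ₑ ∂μ = ENNReal.ofReal a :=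
    (ofReal_integral_norm_eq_lintegral_enorm hdB).symm
  have hbe : ∫⁻ x in B, ‖u x‖ₑ ∂μ = ENNReal.ofReal b :=
    (ofReal_integral_norm_eq_lintegral_enorm huB).symm
  have hF := (measurable_sq_abs_sub_div_rpow hu.continuous ((d : ℝ) + s)).ennreal_ofReal
  rw [setLIntegral_prod_eq_lintegral_add μ hB hF]
  have hincr : ∀ h : E, ∫⁻ x in B ∩ (fun x => x + h) ⁻¹' B, ‖u (x + h) - u x‖ₑ ∂μ ≤
      ENNReal.ofReal (min (‖h‖ * a) (2 * b)) := by
    intro h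
    rw [ENNReal.ofReal_min, ENNReal.ofReal_mul (norm_nonneg _), ENNReal.ofReal_mul zero_le_two,
      ← hae, ← hbe, ofReal_norm, ENNReal.ofReal_ofNat]
    exact le_min (hBc.setLIntegral_enorm_sub_le_fderiv μ hB hu h)
      (setLIntegral_enorm_sub_le_two_mul μ hB hu.continuous.measurable h)
  calc _ ≤ ∫⁻ h, 2 * ENNReal.ofReal (min (‖h‖ * a) (2 * b) * ‖h‖ ^ (-((d : ℝ) + s))) ∂μ := by
        refine lintegral_mono fun h => ?_
        calc _ ≤ ∫⁻ x in B ∩ (fun x => x + h) ⁻¹' B,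
              2 * ENNReal.ofReal (‖h‖ ^ (-((d : ℝ) + s))) * ‖u (x + h) - u x‖ₑ ∂μ := by
              refine setLIntegral_mono' (hB.inter (measurable_add_const h hB)) fun x hx => ?_
              have hx1 := hu1 x hx.1
              have hx2 := hu1 (x + h) hx.2
              rw [← ENNReal.ofReal_ofNat, ← ENNReal.ofReal_mul zero_le_two,
                ← ofReal_norm, ← ENNReal.ofReal_mul (by positivity)]
              refine ENNReal.ofReal_le_ofReal ?_
              have hn : ‖x - (x + h)‖ = ‖h‖ := by simp
              rw [hn, rpow_neg (norm_nonneg h), div_eq_mul_inv, abs_sub_comm, norm_eq_abs, sq]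
              have h2 : |u (x + h) - u x| ≤ 2 := (abs_sub _ _).trans (by linarith)
              have h3 : 0 ≤ (‖h‖ ^ ((d : ℝ) + s))⁻¹ := by positivity
              have h4 := mul_le_mul_of_nonneg_right h2
                (mul_nonneg (abs_nonneg (u (x + h) - u x)) h3)
              linarith
          _ ≤ _ := by
              rw [lintegral_const_mul' _ _ (by finiteness), mul_assoc,
                ENNReal.ofReal_mul (by positivity), mul_comm (ENNReal.ofReal (min _ _))]
              gcongr
              exact hincr h
    _ ≤ _ := by
        rw [lintegral_const_mul' _ _ (by finiteness),
          lintegral_min_mul_rpow_norm μ ha (mul_nonneg zero_le_two hb) hs,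
          ← ENNReal.ofReal_ofNat, ← ENNReal.ofReal_mul zero_le_two,
          mul_rpow zero_le_two hb]
        refine ENNReal.ofReal_le_ofReal ?_
        have hs1 : 0 < (1 - s) * s := mul_pos (by linarith [hs.2]) hs.1
        have h2 : (2 : ℝ) ^ (1 - s) ≤ 2 := by
          simpa using rpow_le_rpow_of_exponent_le one_le_two (by linarith [hs.1] : 1 - s ≤ 1)
        calc 2 * (d * μ.real (Metric.ball 0 1) * (a ^ s * (2 ^ (1 - s) * b ^ (1 - s)) /
              ((1 - s) * s)))
            ≤ 2 * (d * μ.real (Metric.ball 0 1) * (a ^ s * (2 * b ^ (1 - s)) /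
              ((1 - s) * s))) := by gcongr
          _ = _ := by ring

/-- Interpolation inequality (Proposition 4.10): for `s ∈ (0,1)` and `u : B₁ → [-1,1]` of
class `C¹`, the Gagliardo energy on `B₁ × B₁` is bounded by
`(C/((1-s)s)) ‖∇u‖_{L¹(B₁)}^s ‖u‖_{L¹(B₁)}^{1-s}` with `C = C(n)`. -/
theorem gagliardo_interpolation (n : ℕ) (hn : 1 ≤ n) :
    ∃ C : ℝ, 0 < C ∧
      ∀ s : ℝ, s ∈ Ioo (0:ℝ) 1 →
      ∀ u : EuclideanSpace ℝ (Fin n) → ℝ, ContDiff ℝ 1 u →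
        (∀ x : EuclideanSpace ℝ (Fin n), ‖x‖ < 1 → |u x| ≤ 1) →
        (∫ q in (Metric.ball (0 : EuclideanSpace ℝ (Fin n)) 1) ×ˢ
            (Metric.ball (0 : EuclideanSpace ℝ (Fin n)) 1),
            |u q.1 - u q.2| ^ 2 / ‖q.1 - q.2‖ ^ ((n : ℝ) + s)) ≤
          C / ((1 - s) * s) *
            (∫ x in Metric.ball (0 : EuclideanSpace ℝ (Fin n)) 1, ‖fderiv ℝ u x‖) ^ s *
            (∫ x in Metric.ball (0 : EuclideanSpace ℝ (Fin n)) 1, |u x|) ^ (1 - s) := by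
  have : NeZero n := ⟨by omega⟩
  have hvol : 0 < (volume : Measure (EuclideanSpace ℝ (Fin n))).real (Metric.ball 0 1) :=
    ENNReal.toReal_pos (Metric.measure_ball_pos _ _ one_pos).ne' measure_ball_lt_top.ne
  have hn0 : (0 : ℝ) < n := by exact_mod_cast hn
  refine ⟨4 * (n * (volume : Measure (EuclideanSpace ℝ (Fin n))).real (Metric.ball 0 1)),
    by positivity, fun s hs u hu hu1 => ?_⟩
  have h_integrable : ∀ {F : Type} [NormedAddCommGroup F] {f : EuclideanSpace ℝ (Fin n) → F},
      Continuous f → IntegrableOn f (Metric.ball 0 1) := fun hf =>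
    (hf.continuousOn.integrableOn_compact (isCompact_closedBall 0 1)).mono_set
      Metric.ball_subset_closedBall
  have key := setLIntegral_gagliardo_le volume (convex_ball (0 : EuclideanSpace ℝ (Fin n)) 1)
    measurableSet_ball hu (fun x hx => hu1 x (mem_ball_zero_iff.1 hx)) (h_integrable hu.continuous)
    (h_integrable (hu.continuous_fderiv one_ne_zero)) hs
  rw [finrank_euclideanSpace_fin, ← Measure.volume_eq_prod] at key
  have hs1 : 0 < (1 - s) * s := mul_pos (by linarith [hs.2]) hs.1
  rw [integral_eq_lintegral_of_nonneg_ae (ae_of_all _ fun q => by positivity)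
    (measurable_sq_abs_sub_div_rpow hu.continuous _).aestronglyMeasurable]
  have ha : 0 ≤ ∫ x in Metric.ball (0 : EuclideanSpace ℝ (Fin n)) 1, ‖fderiv ℝ u x‖ :=
    integral_nonneg fun _ => norm_nonneg _
  have hb : 0 ≤ ∫ x in Metric.ball (0 : EuclideanSpace ℝ (Fin n)) 1, |u x| :=
    integral_nonneg fun _ => abs_nonneg _
  exact ENNReal.toReal_le_of_le_ofReal (by positivity) key
end
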